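/- arXiv:2510.18654 — 12 statements merged into one kernel-verified Lean document; each statement's English description precedes it below -/
import Mathlib

section
/- Let (Ω, P) be a probability space, let E : Ω → ℝ be a nonnegative random variable with 𝔼[E] ≤ 1, let α > 1, ε > 0, and Δ ≥ 0, and let ξ : Ω → ℝ be a random variable independent of E whose law is the Gaussian measure on ℝ with mean α·Δ²/(4ε) and variance α·Δ²/(2ε). Then the random variable E·e^{−ξ} is nonnegative and satisfies 𝔼[E·e^{−ξ}] ≤ 1. -/
open MeasureTheory ProbabilityTheory

/-- Biased Gaussian mechanism preserves e-value validity (Theorem 3.1, validity part):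
if `E` is a nonnegative random variable with `𝔼[E] ≤ 1` and `ξ` is independent Gaussian
noise with mean `α·Δ²/(4ε)` and variance `α·Δ²/(2ε)`, then `E·e^{−ξ}` is nonnegative
with expectation at most one. -/
theorem biased_gaussian_evalue_valid
    {Ω : Type*} [MeasurableSpace Ω] (P : Measure Ω) [IsProbabilityMeasure P]
    (E ξ : Ω → ℝ) (α ε Δ : ℝ) (hα : 1 < α) (hε : 0 < ε) (hΔ : 0 ≤ Δ)
    (hE_nonneg : ∀ ω, 0 ≤ E ω) (hE_int : Integrable E P)
    (hE_mean : ∫ ω, E ω ∂P ≤ 1)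
    (hξ_meas : AEMeasurable ξ P)
    (hindep : IndepFun E ξ P)
    (hlaw : Measure.map ξ P =
      gaussianReal (α * Δ ^ 2 / (4 * ε)) (Real.toNNReal (α * Δ ^ 2 / (2 * ε)))) :
    (∀ ω, 0 ≤ E ω * Real.exp (-ξ ω)) ∧
      ∫ ω, E ω * Real.exp (-ξ ω) ∂P ≤ 1 := by
  refine ⟨fun ω => mul_nonneg (hE_nonneg ω) (Real.exp_pos _).le, ?_⟩
  have hmeas : Measurable (fun x : ℝ => Real.exp (-x)) := by fun_prop
  have hind : IndepFun E (fun ω => Real.exp (-ξ ω)) P :=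
    hindep.comp measurable_id hmeas
  have hmul : ∫ ω, E ω * Real.exp (-ξ ω) ∂P
      = (∫ ω, E ω ∂P) * ∫ ω, Real.exp (-ξ ω) ∂P :=
    hind.integral_fun_mul_eq_mul_integral hE_int.aestronglyMeasurable
      (hmeas.comp_aemeasurable hξ_meas).aestronglyMeasurable
  have hv : 0 ≤ α * Δ ^ 2 / (2 * ε) := by positivity
  have hmgf := mgf_gaussianReal hlaw (-1)
  have h1 : ∫ ω, Real.exp (-ξ ω) ∂P = 1 := by
    have h2 : mgf ξ P (-1) = ∫ ω, Real.exp (-ξ ω) ∂P := by simp [mgf]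
    rw [← h2, hmgf, Real.coe_toNNReal _ hv, Real.exp_eq_one_iff]
    field_simp
    ring
  rw [hmul, h1, mul_one]
  exact hE_mean
end

section
/- Let m₁, m₂ ∈ ℝ, v > 0, and α > 1. Writing φ_{m,v}(x) = (1/√(2πv))·exp(−(x−m)²/(2v)) for the Gaussian probability density with mean m and variance v, one has ∫_ℝ φ_{m₁,v}(x)^α · φ_{m₂,v}(x)^{1−α} dx = exp( α(α−1)(m₁−m₂)² / (2v) ). Equivalently, the α-Rényi divergence (1/(α−1))·log ∫ φ_{m₁,v}^α φ_{m₂,v}^{1−α} between the two Gaussians equals α(m₁−m₂)²/(2v). -/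
open MeasureTheory Real

/-- Rényi divergence between two Gaussians with the same variance (key computation for the
privacy analysis of the biased Gaussian mechanism): with `φ m v` the Gaussian density of
mean `m` and variance `v`, `∫ φ_{m₁,v}^α · φ_{m₂,v}^{1−α} = exp(α(α−1)(m₁−m₂)²/(2v))`,
so the α-Rényi divergence equals `α(m₁−m₂)²/(2v)`. -/
theorem renyi_divergence_gaussian (m₁ m₂ v α : ℝ) (hv : 0 < v) (hα : 1 < α)
    (φ : ℝ → ℝ → ℝ)
    (hφ : ∀ m x, φ m x =
      (1 / Real.sqrt (2 * Real.pi * v)) * Real.exp (-(x - m) ^ 2 / (2 * v))) :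
    (∫ x : ℝ, φ m₁ x ^ α * φ m₂ x ^ (1 - α)
        = Real.exp (α * (α - 1) * (m₁ - m₂) ^ 2 / (2 * v))) ∧
      (1 / (α - 1)) * Real.log (∫ x : ℝ, φ m₁ x ^ α * φ m₂ x ^ (1 - α))
        = α * (m₁ - m₂) ^ 2 / (2 * v) := by
  have hs : 0 < 1 / Real.sqrt (2 * Real.pi * v) := by positivity
  have hpt : ∀ x, φ m₁ x ^ α * φ m₂ x ^ (1 - α) =
      Real.exp (α * (α - 1) * (m₁ - m₂) ^ 2 / (2 * v)) *
        ProbabilityTheory.gaussianPDFReal (α * m₁ + (1 - α) * m₂) v.toNNReal x := by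
    intro x
    rw [hφ, hφ, ProbabilityTheory.gaussianPDFReal_def,
      Real.mul_rpow hs.le (Real.exp_pos _).le, Real.mul_rpow hs.le (Real.exp_pos _).le,
      ← Real.exp_mul, ← Real.exp_mul, mul_mul_mul_comm, ← Real.rpow_add hs, ← Real.exp_add,
      add_sub_cancel, Real.rpow_one]
    simp only [Real.coe_toNNReal v hv.le]
    change _ = Real.exp _ * ((Real.sqrt (2 * Real.pi * v))⁻¹ *
      Real.exp (-(x - (α * m₁ + (1 - α) * m₂)) ^ 2 / (2 * v)))
    rw [mul_left_comm, ← Real.exp_add, one_div]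
    congr 2
    field_simp
    ring
  have hI : ∫ x : ℝ, φ m₁ x ^ α * φ m₂ x ^ (1 - α)
        = Real.exp (α * (α - 1) * (m₁ - m₂) ^ 2 / (2 * v)) := by
    simp_rw [hpt]
    rw [integral_const_mul, ProbabilityTheory.integral_gaussianPDFReal_eq_one, mul_one]
    exact (Real.toNNReal_pos.mpr hv).ne'
  refine ⟨hI, ?_⟩
  have h1 : α - 1 ≠ 0 := by linarith
  rw [hI, Real.log_exp]
  field_simp
end

section
/- Let (Ω, P) be a probability space, let E : Ω → ℝ be a nonnegative random variable with 𝔼[E] ≤ 1, let b ∈ (0,1), and let ξ : Ω → ℝ be a random variable independent of E whose law has density x ↦ (1/(2b))·exp(−|x − μ₀|/b) with respect to Lebesgue measure, where μ₀ = −log(1 − b²). Then the random variable E·e^{−ξ} is nonnegative and satisfies 𝔼[E·e^{−ξ}] ≤ 1. -/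
open MeasureTheory ProbabilityTheory

lemma laplace_aux (b : ℝ) (h0 : 0 < b) (h1 : b < 1) :
    ∫ y : ℝ, Real.exp (-|y| / b - y) = 2 * b / (1 - b ^ 2) := by
  have hb1 : 1 < 1 / b := by rw [lt_div_iff₀ h0]; linarith
  have e1 : ∀ y ∈ Set.Iic (0 : ℝ), Real.exp (-|y| / b - y) = Real.exp ((1 / b - 1) * y) := by
    intro y hy
    rw [abs_of_nonpos hy]; congr 1; field_simp
  have e2 : ∀ y ∈ Set.Ioi (0 : ℝ), Real.exp (-|y| / b - y) = Real.exp ((-(1 / b) - 1) * y) := by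
    intro y hy
    rw [abs_of_pos hy]; congr 1; field_simp
  have i1 : IntegrableOn (fun y : ℝ => Real.exp (-|y| / b - y)) (Set.Iic 0) :=
    (integrableOn_congr_fun e1 measurableSet_Iic).2
      (integrableOn_exp_mul_Iic (by linarith) 0)
  have i2 : IntegrableOn (fun y : ℝ => Real.exp (-|y| / b - y)) (Set.Ioi 0) :=
    (integrableOn_congr_fun e2 measurableSet_Ioi).2
      (integrableOn_exp_mul_Ioi (by linarith) 0)
  rw [← intervalIntegral.integral_Iic_add_Ioi i1 i2,
    setIntegral_congr_fun measurableSet_Iic e1, setIntegral_congr_fun measurableSet_Ioi e2,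
    integral_exp_mul_Iic (by linarith), integral_exp_mul_Ioi (by linarith)]
  have a1 : 1 - b ≠ 0 := by linarith
  have a2 : 1 + b ≠ 0 := by linarith
  have a3 : 1 - b ^ 2 ≠ 0 := by nlinarith
  have q1 : 1 / b - 1 = (1 - b) / b := by field_simp
  have q2 : -(1 / b) - 1 = -((1 + b) / b) := by field_simp; ring
  rw [q1, q2]
  simp only [mul_zero, Real.exp_zero]
  rw [show 1 - b ^ 2 = (1 - b) * (1 + b) by ring]
  field_simp
  ring

lemma laplace_mgf (b : ℝ) (h0 : 0 < b) (h1 : b < 1) :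
    ∫ x : ℝ, ((1 / (2 * b)) * Real.exp (-|x - (-Real.log (1 - b ^ 2))| / b)) * Real.exp (-x)
      = 1 := by
  have hp : 0 < 1 - b ^ 2 := by nlinarith
  rw [← integral_add_right_eq_self _ (-Real.log (1 - b ^ 2))]
  have : ∀ y : ℝ, ((1 / (2 * b)) * Real.exp (-|y + -Real.log (1 - b ^ 2)
      - (-Real.log (1 - b ^ 2))| / b)) * Real.exp (-(y + -Real.log (1 - b ^ 2)))
      = ((1 - b ^ 2) / (2 * b)) * Real.exp (-|y| / b - y) := by
    intro y
    rw [add_sub_cancel_right, neg_add, neg_neg, Real.exp_add, Real.exp_log hp,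
      sub_eq_add_neg (-|y| / b) y, Real.exp_add]
    ring
  simp_rw [this]
  rw [integral_const_mul, laplace_aux b h0 h1]
  field_simp

/-- Biased Laplace mechanism preserves e-value validity (Theorem 3.2, validity part):
if `E` is a nonnegative random variable with `𝔼[E] ≤ 1` and `ξ` is independent
Laplace noise with location `−log(1−b²)` and scale `b ∈ (0,1)`, then `E·e^{−ξ}` is
nonnegative with expectation at most one. -/
theorem biased_laplace_evalue_valid
    {Ω : Type*} [MeasurableSpace Ω] (P : Measure Ω) [IsProbabilityMeasure P]
    (E ξ : Ω → ℝ) (b : ℝ) (hb : b ∈ Set.Ioo (0 : ℝ) 1)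
    (hE_nonneg : ∀ ω, 0 ≤ E ω) (hE_int : Integrable E P)
    (hE_mean : ∫ ω, E ω ∂P ≤ 1)
    (hξ_meas : AEMeasurable ξ P)
    (hindep : IndepFun E ξ P)
    (hlaw : Measure.map ξ P = volume.withDensity (fun x =>
      ENNReal.ofReal
        ((1 / (2 * b)) * Real.exp (-|x - (-Real.log (1 - b ^ 2))| / b)))) :
    (∀ ω, 0 ≤ E ω * Real.exp (-ξ ω)) ∧
      ∫ ω, E ω * Real.exp (-ξ ω) ∂P ≤ 1 := by
  refine ⟨fun ω => mul_nonneg (hE_nonneg ω) (Real.exp_pos _).le, ?_⟩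
  have hm : Measurable (fun x : ℝ => Real.exp (-x)) := by fun_prop
  have hmE : AEMeasurable (fun ω => Real.exp (-ξ ω)) P := hm.comp_aemeasurable hξ_meas
  have hi : IndepFun E (fun ω => Real.exp (-ξ ω)) P := hindep.comp measurable_id hm
  rw [hi.integral_fun_mul_eq_mul_integral hE_int.1 hmE.aestronglyMeasurable]
  have key : ∫ ω, Real.exp (-ξ ω) ∂P = 1 := by
    rw [← integral_map (f := fun x => Real.exp (-x)) hξ_meas hm.aestronglyMeasurable, hlaw,
      integral_withDensity_eq_integral_toReal_smul (by fun_prop) (by simp)]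
    refine Eq.trans ?_ (laplace_mgf b hb.1 hb.2)
    congr 1
    ext x
    have := hb.1
    rw [ENNReal.toReal_ofReal (by positivity), smul_eq_mul]
  rw [key, mul_one]
  exact hE_mean
end

section
/- Let μ ∈ ℝ and b ∈ (0,1). Then ∫_ℝ e^{−x} · (1/(2b))·exp(−|x − μ|/b) dx ≤ 1 if and only if μ ≥ −log(1 − b²). -/
open MeasureTheory

lemma laplace_mgf_aux (μ b : ℝ) (hb0 : 0 < b) (hb1 : b < 1) :
    (∫ x : ℝ, Real.exp (-x) * ((1 / (2 * b)) * Real.exp (-|x - μ| / b)))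
      = Real.exp (-μ) / (1 - b ^ 2) := by
  have h1 : 0 < 1 / b - 1 := by
    have : 1 < 1 / b := by rw [lt_div_iff₀ hb0]; linarith
    linarith
  have h2 : -(1 / b + 1) < 0 := by
    have : 0 < 1 / b := by positivity
    linarith
  have e1 : Set.EqOn (fun x : ℝ => Real.exp (-x) * ((1 / (2 * b)) * Real.exp (-|x - μ| / b)))
      (fun x => (1 / (2 * b) * Real.exp (-μ / b)) * Real.exp ((1 / b - 1) * x)) (Set.Iic μ) := by
    intro x hx
    have hx' : x ≤ μ := hx
    have h : |x - μ| = -(x - μ) := abs_of_nonpos (by linarith)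
    have h' : (1 / b - 1) * x = -x + (-(-(x - μ)) / b + μ / b) := by ring
    have h'' : Real.exp (-μ / b) * Real.exp (μ / b) = 1 := by
      rw [← Real.exp_add]; simp [neg_div]
    simp only [h]
    rw [h', Real.exp_add, Real.exp_add]
    linear_combination (-Real.exp (-x) * Real.exp (-(-(x - μ)) / b) * (1 / (2 * b))) * h''
  have e2 : Set.EqOn (fun x : ℝ => Real.exp (-x) * ((1 / (2 * b)) * Real.exp (-|x - μ| / b)))
      (fun x => (1 / (2 * b) * Real.exp (μ / b)) * Real.exp (-(1 / b + 1) * x)) (Set.Ioi μ) := by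
    intro x hx
    have hx' : μ < x := hx
    have h : |x - μ| = x - μ := abs_of_nonneg (by linarith)
    have h' : -(1 / b + 1) * x = -x + (-(x - μ) / b + -μ / b) := by ring
    have h'' : Real.exp (-μ / b) * Real.exp (μ / b) = 1 := by
      rw [← Real.exp_add]; simp [neg_div]
    simp only [h]
    rw [h', Real.exp_add, Real.exp_add]
    linear_combination (-Real.exp (-x) * Real.exp (-(x - μ) / b) * (1 / (2 * b))) * h''
  have i1 := ((integrableOn_exp_mul_Iic h1 μ).const_mul
    (1 / (2 * b) * Real.exp (-μ / b)))
  have i2 := ((integrableOn_exp_mul_Ioi h2 μ).const_mul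
    (1 / (2 * b) * Real.exp (μ / b)))
  rw [← intervalIntegral.integral_Iic_add_Ioi
    (IntegrableOn.congr_fun i1 e1.symm measurableSet_Iic)
    (IntegrableOn.congr_fun i2 e2.symm measurableSet_Ioi),
    setIntegral_congr_fun measurableSet_Iic e1, setIntegral_congr_fun measurableSet_Ioi e2,
    integral_const_mul, integral_const_mul, integral_exp_mul_Iic h1, integral_exp_mul_Ioi h2]
  have k1 : Real.exp (-μ / b) * Real.exp ((1 / b - 1) * μ) = Real.exp (-μ) := by
    rw [← Real.exp_add]; congr 1; ring
  have k2 : Real.exp (μ / b) * Real.exp (-(1 / b + 1) * μ) = Real.exp (-μ) := by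
    rw [← Real.exp_add]; congr 1; ring
  have hA : 1 / (2 * b) / (1 / b - 1) = 1 / (2 * (1 - b)) := by
    have : 1 - b ≠ 0 := by linarith
    have : 1 / b - 1 = (1 - b) / b := by field_simp
    rw [this]; field_simp
  have hB : 1 / (2 * b) / (-(1 / b + 1)) = -(1 / (2 * (1 + b))) := by
    have : 1 + b ≠ 0 := by linarith
    have : 1 / b + 1 = (1 + b) / b := by field_simp
    rw [this]; field_simp
  have hC : 1 / (2 * (1 - b)) + 1 / (2 * (1 + b)) = 1 / (1 - b ^ 2) := by
    have a1 : 1 - b ≠ 0 := by linarith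
    have a2 : 1 + b ≠ 0 := by linarith
    have : 1 - b ^ 2 = (1 - b) * (1 + b) := by ring
    rw [this]; field_simp; ring
  calc _ = (Real.exp (-μ / b) * Real.exp ((1 / b - 1) * μ)) * (1 / (2 * b) / (1 / b - 1))
        - (Real.exp (μ / b) * Real.exp (-(1 / b + 1) * μ)) * (1 / (2 * b) / (-(1 / b + 1))) := by
          ring
    _ = Real.exp (-μ) * (1 / (2 * (1 - b)) + 1 / (2 * (1 + b))) := by
          rw [k1, k2, hA, hB]; ring
    _ = _ := by rw [hC]; ring

/-- Characterization of the smallest bias for the Laplace mechanism: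
for `b ∈ (0,1)`, `∫ e^{−x} · (1/(2b))·e^{−|x−μ|/b} dx ≤ 1` iff `μ ≥ −log(1 − b²)`. -/
theorem laplace_mgf_le_one_iff (μ b : ℝ) (hb : b ∈ Set.Ioo (0 : ℝ) 1) :
    (∫ x : ℝ, Real.exp (-x) * ((1 / (2 * b)) * Real.exp (-|x - μ| / b))) ≤ 1 ↔
      -Real.log (1 - b ^ 2) ≤ μ := by
  obtain ⟨hb0, hb1⟩ := hb
  have hp : 0 < 1 - b ^ 2 := by nlinarith
  rw [laplace_mgf_aux μ b hb0 hb1, div_le_one hp, ← Real.le_log_iff_exp_le hp]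
  exact neg_le
end

section
/- Let α > 1, b > 0, and μ ∈ ℝ. Writing f_{m,b}(x) = (1/(2b))·exp(−|x−m|/b) for the Laplace density with location m and scale b, one has ∫_ℝ f_{0,b}(x)^α · f_{μ,b}(x)^{1−α} dx = (α/(2α−1))·e^{(α−1)|μ|/b} + ((α−1)/(2α−1))·e^{−α|μ|/b}. Equivalently, the α-Rényi divergence of Laplace(0,b) from Laplace(μ,b) equals (1/(α−1))·log( (α/(2α−1))·e^{(α−1)|μ|/b} + ((α−1)/(2α−1))·e^{−α|μ|/b} ). -/
open MeasureTheory Real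

lemma renyi_aux (α b m : ℝ) (hα : 1 < α) (hb : 0 < b) (hm : 0 ≤ m) :
    ∫ x : ℝ, (1 / (2 * b)) * Real.exp ((-α * |x| + (α - 1) * |x - m|) / b)
      = (α / (2 * α - 1)) * Real.exp ((α - 1) * m / b)
          + ((α - 1) / (2 * α - 1)) * Real.exp (-α * m / b) := by
  set g : ℝ → ℝ := fun x => Real.exp ((-α * |x| + (α - 1) * |x - m|) / b) with hg
  have hb' : b ≠ 0 := hb.ne'
  have hc : 2 * α - 1 ≠ 0 := by linarith
  have hcont : Continuous g := by
    rw [hg]; fun_prop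
  have e1 : Set.EqOn g (fun x => Real.exp ((α - 1) * m / b) * Real.exp (1 / b * x)) (Set.Iic 0) := by
    intro x hx
    have hx : x ≤ 0 := hx
    simp only [hg]
    rw [abs_of_nonpos hx, abs_of_nonpos (by linarith), ← Real.exp_add]
    congr 1; field_simp; ring
  have e2 : Set.EqOn g (fun x => Real.exp ((α - 1) * m / b) * Real.exp (-(2 * α - 1) / b * x))
      (Set.uIcc 0 m) := by
    intro x hx
    rw [Set.uIcc_of_le hm] at hx
    simp only [hg]
    rw [abs_of_nonneg hx.1, abs_of_nonpos (by linarith [hx.2]), ← Real.exp_add]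
    congr 1; field_simp; ring
  have e3 : Set.EqOn g (fun x => Real.exp (-(α - 1) * m / b) * Real.exp (-1 / b * x))
      (Set.Ioi m) := by
    intro x hx
    have hx : m < x := hx
    simp only [hg]
    rw [abs_of_nonneg (by linarith), abs_of_nonneg (by linarith), ← Real.exp_add]
    congr 1; field_simp; ring
  have hp : 0 < 1 / b := by positivity
  have hn : -1 / b < 0 := by rw [neg_div]; linarith
  have hd : -(2 * α - 1) / b ≠ 0 := div_ne_zero (neg_ne_zero.mpr hc) hb'
  have i1 : IntegrableOn g (Set.Iic 0) :=
    IntegrableOn.congr_fun ((integrableOn_exp_mul_Iic hp 0).const_mul _) e1.symm measurableSet_Iic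
  have i3 : IntegrableOn g (Set.Ioi m) :=
    IntegrableOn.congr_fun ((integrableOn_exp_mul_Ioi hn m).const_mul _) e3.symm measurableSet_Ioi
  have i2 : IntegrableOn g (Set.Ioc 0 m) := 
    (hcont.integrableOn_Icc).mono_set Set.Ioc_subset_Icc_self
  have i23 : IntegrableOn g (Set.Ioi 0) := by
    rw [← Set.Ioc_union_Ioi_eq_Ioi hm]; exact i2.union i3
  have v1 : ∫ x in Set.Iic 0, g x = Real.exp ((α - 1) * m / b) * b := by
    rw [setIntegral_congr_fun measurableSet_Iic e1, integral_const_mul, integral_exp_mul_Iic hp]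
    simp
  have v3 : ∫ x in Set.Ioi m, g x = b * Real.exp (-α * m / b) := by
    rw [setIntegral_congr_fun measurableSet_Ioi e3, integral_const_mul, integral_exp_mul_Ioi hn]
    have : Real.exp (-α * m / b) = Real.exp (-(α - 1) * m / b) * Real.exp (-1 / b * m) := by
      rw [← Real.exp_add]; congr 1; field_simp; ring
    rw [this]; field_simp
  have v2 : ∫ x in Set.Ioc 0 m, g x =
      b / (2 * α - 1) * (Real.exp ((α - 1) * m / b) - Real.exp (-α * m / b)) := by
    rw [← intervalIntegral.integral_of_le hm, intervalIntegral.integral_congr e2,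
      intervalIntegral.integral_const_mul,
      intervalIntegral.integral_comp_mul_left (fun x => Real.exp x) hd, integral_exp]
    have : Real.exp (-α * m / b)
        = Real.exp ((α - 1) * m / b) * Real.exp (-(2 * α - 1) / b * m) := by
      rw [← Real.exp_add]; congr 1; field_simp; ring
    rw [this, mul_zero, Real.exp_zero, smul_eq_mul]; field_simp; ring
  rw [integral_const_mul]
  change 1 / (2 * b) * ∫ x, g x = _
  rw [← intervalIntegral.integral_Iic_add_Ioi i1 i23, ← Set.Ioc_union_Ioi_eq_Ioi hm,
    setIntegral_union (Set.Ioc_disjoint_Ioi le_rfl) measurableSet_Ioi i2 i3, v1, v2, v3]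
  field_simp
  ring

/-- Rényi divergence between two Laplace distributions with the same scale (Lemma A.3):
with `f m x = (1/(2b))·e^{−|x−m|/b}` the Laplace density,
`∫ f_0^α · f_μ^{1−α} = (α/(2α−1))·e^{(α−1)|μ|/b} + ((α−1)/(2α−1))·e^{−α|μ|/b}`,
and consequently the α-Rényi divergence is `(1/(α−1))·log` of that quantity. -/
theorem renyi_divergence_laplace (α b μ : ℝ) (hα : 1 < α) (hb : 0 < b)
    (f : ℝ → ℝ → ℝ)
    (hf : ∀ m x, f m x = (1 / (2 * b)) * Real.exp (-|x - m| / b)) :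
    (∫ x : ℝ, f 0 x ^ α * f μ x ^ (1 - α)
        = (α / (2 * α - 1)) * Real.exp ((α - 1) * |μ| / b)
          + ((α - 1) / (2 * α - 1)) * Real.exp (-α * |μ| / b)) ∧
      (1 / (α - 1)) * Real.log (∫ x : ℝ, f 0 x ^ α * f μ x ^ (1 - α))
        = (1 / (α - 1)) * Real.log
            ((α / (2 * α - 1)) * Real.exp ((α - 1) * |μ| / b)
              + ((α - 1) / (2 * α - 1)) * Real.exp (-α * |μ| / b)) := by
  have key : ∫ x : ℝ, f 0 x ^ α * f μ x ^ (1 - α)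
        = (α / (2 * α - 1)) * Real.exp ((α - 1) * |μ| / b)
          + ((α - 1) / (2 * α - 1)) * Real.exp (-α * |μ| / b) := by
    have hfun : ∀ x, f 0 x ^ α * f μ x ^ (1 - α)
        = (1 / (2 * b)) * Real.exp ((-α * |x| + (α - 1) * |x - μ|) / b) := by
      intro x
      have hk : 0 < 1 / (2 * b) := by positivity
      rw [hf, hf, Real.mul_rpow hk.le (Real.exp_pos _).le,
        Real.mul_rpow hk.le (Real.exp_pos _).le, mul_mul_mul_comm, ← Real.rpow_add hk,
        ← Real.exp_mul, ← Real.exp_mul, ← Real.exp_add, add_sub_cancel, Real.rpow_one, sub_zero]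
      congr 2; field_simp; ring
    simp_rw [hfun]
    rw [← renyi_aux α b |μ| hα hb (abs_nonneg _)]
    rcases le_total 0 μ with h | h
    · rw [abs_of_nonneg h]
    · rw [abs_of_nonpos h, ← integral_neg_eq_self]
      congr 1; ext x
      rw [abs_neg, show -x - μ = -(x - -μ) by ring, abs_neg]
  exact ⟨key, by rw [key]⟩
end

section
/- Let α > 1 and b > 0. The function μ ↦ (1/(α−1))·log( (α/(2α−1))·e^{(α−1)μ/b} + ((α−1)/(2α−1))·e^{−αμ/b} ) is strictly increasing on [0, ∞). Consequently, the α-Rényi divergence between Laplace(0, b) and Laplace(μ, b) is increasing in |μ|. -/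
open Real

/-- The Rényi divergence between `Laplace(0,b)` and `Laplace(μ,b)`, as a function of `μ`,
is strictly increasing on `[0, ∞)`; consequently it is increasing in `|μ|`. -/
theorem renyi_divergence_laplace_strictMono (α b : ℝ) (hα : 1 < α) (hb : 0 < b)
    (g : ℝ → ℝ)
    (hg : ∀ μ, g μ = (1 / (α - 1)) * Real.log
      ((α / (2 * α - 1)) * Real.exp ((α - 1) * μ / b)
        + ((α - 1) / (2 * α - 1)) * Real.exp (-α * μ / b))) :
    StrictMonoOn g (Set.Ici 0) ∧
      ∀ μ₁ μ₂ : ℝ, |μ₁| ≤ |μ₂| → g |μ₁| ≤ g |μ₂| := by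
  have h1 : 0 < α - 1 := by linarith
  have h2 : 0 < 2 * α - 1 := by linarith
  have h0 : 0 < α := by linarith
  have hd : ∀ x : ℝ, HasDerivAt (fun μ : ℝ => (α / (2 * α - 1)) * Real.exp ((α - 1) * μ / b)
        + ((α - 1) / (2 * α - 1)) * Real.exp (-α * μ / b))
      ((α / (2 * α - 1)) * (Real.exp ((α - 1) * x / b) * ((α - 1) * 1 / b))
        + ((α - 1) / (2 * α - 1)) * (Real.exp (-α * x / b) * (-α * 1 / b))) x := by
    intro x
    exact (((((hasDerivAt_id x).const_mul (α - 1)).div_const b).exp).const_mul _).add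
      (((((hasDerivAt_id x).const_mul (-α)).div_const b).exp).const_mul _)
  have hmono : StrictMonoOn (fun μ : ℝ => (α / (2 * α - 1)) * Real.exp ((α - 1) * μ / b)
        + ((α - 1) / (2 * α - 1)) * Real.exp (-α * μ / b)) (Set.Ici 0) := by
    apply strictMonoOn_of_deriv_pos (convex_Ici 0)
    · exact fun x _ => (hd x).continuousAt.continuousWithinAt
    · intro x hx
      rw [interior_Ici, Set.mem_Ioi] at hx
      rw [(hd x).deriv]
      have hlt : Real.exp (-α * x / b) < Real.exp ((α - 1) * x / b) := by
        apply Real.exp_lt_exp.mpr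
        apply div_lt_div_of_pos_right _ hb
        nlinarith
      have hc : 0 < α * (α - 1) / ((2 * α - 1) * b) := by positivity
      have := mul_pos hc (sub_pos.mpr hlt)
      refine this.trans_eq ?_
      field_simp
      ring
  have hg' : StrictMonoOn g (Set.Ici 0) := by
    intro x hx y hy hxy
    rw [hg, hg]
    apply mul_lt_mul_of_pos_left _ (by positivity)
    exact Real.log_lt_log (by positivity) (hmono hx hy hxy)
  exact ⟨hg', fun μ₁ μ₂ h => hg'.monotoneOn (abs_nonneg μ₁) (abs_nonneg μ₂) h⟩
end

section
/- Let (Ω, P) be a probability space, let a₁ ≤ a₂ be reals, L ≥ 0, and let (E_θ)_{θ ∈ [a₁,a₂]} be a family of strictly positive random variables on Ω such that (i) 𝔼[E_{θ'}] ≤ 1 for every θ' ∈ [a₁, a₂], and (ii) for every ω ∈ Ω the map θ ↦ log E_θ(ω) is L-Lipschitz on [a₁, a₂]. Let θ_m = (a₁ + a₂)/2. Then for every θ' ∈ [a₁, a₂] one has E_{θ'}(ω) ≥ E_{θ_m}(ω)·e^{−L·(a₂ − a₁)} for all ω, and consequently 𝔼[ E_{θ_m}·e^{−L·(a₂ − a₁)}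 ] ≤ 1. -/
open MeasureTheory

/-- Discretization step for e-value-based confidence intervals (Equation 3): if each `E θ'`
is an e-value and `θ ↦ log (E θ ω)` is `L`-Lipschitz on `[a₁, a₂]`, then the deflated
variable `E θ_m · e^{−L(a₂−a₁)}` (with `θ_m` the midpoint) is pointwise below every `E θ'`
and has expectation at most one. -/
theorem discretized_evalue_valid
    {Ω : Type*} [MeasurableSpace Ω] (P : Measure Ω) [IsProbabilityMeasure P]
    (a₁ a₂ L : ℝ) (hle : a₁ ≤ a₂) (hL : 0 ≤ L)
    (E : ℝ → Ω → ℝ)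
    (hpos : ∀ θ ∈ Set.Icc a₁ a₂, ∀ ω, 0 < E θ ω)
    (hmean : ∀ θ ∈ Set.Icc a₁ a₂, ∫ ω, E θ ω ∂P ≤ 1)
    (hlip : ∀ ω, ∀ θ ∈ Set.Icc a₁ a₂, ∀ θ' ∈ Set.Icc a₁ a₂,
      |Real.log (E θ ω) - Real.log (E θ' ω)| ≤ L * |θ - θ'|) :
    (∀ θ' ∈ Set.Icc a₁ a₂, ∀ ω,
        E ((a₁ + a₂) / 2) ω * Real.exp (-L * (a₂ - a₁)) ≤ E θ' ω) ∧
      ∫ ω, E ((a₁ + a₂) / 2) ω * Real.exp (-L * (a₂ - a₁)) ∂P ≤ 1 := by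
  have hm : (a₁ + a₂) / 2 ∈ Set.Icc a₁ a₂ := ⟨by linarith, by linarith⟩
  refine ⟨fun θ' hθ' ω => ?_, ?_⟩
  · have h1 := (le_abs_self _).trans (hlip ω _ hm θ' hθ')
    have h2 : |(a₁ + a₂) / 2 - θ'| ≤ a₂ - a₁ := by
      rw [abs_le]
      constructor <;> linarith [hθ'.1, hθ'.2]
    have h3 := mul_le_mul_of_nonneg_left h2 hL
    rw [← Real.exp_log (hpos _ hm ω), ← Real.exp_log (hpos _ hθ' ω), ← Real.exp_add]
    apply Real.exp_le_exp.mpr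
    linarith
  · rw [integral_mul_const]
    have h1 : Real.exp (-L * (a₂ - a₁)) ≤ 1 := by
      apply Real.exp_le_one_iff.mpr
      nlinarith [mul_nonneg hL (sub_nonneg.mpr hle)]
    exact mul_le_one₀ (hmean _ hm) (Real.exp_pos _).le h1
end

section
/- Let θ ∈ (0, 1) and let λ_inf ≤ λ_sup be reals with −1/(1−θ) < λ_inf and λ_sup < 1/θ. Then for every λ ∈ [λ_inf, λ_sup] and every y ∈ [0, 1], one has 1 + λ(y − θ) > 0 and |log(1 + λ(y − θ))| ≤ max{ log(1 + max{λ_sup·(1−θ), −λ_inf·θ}), −log(1 + min{λ_inf·(1−θ), −λ_sup·θ}) }. -/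
open Real

/-- Key inequality of Proposition 4.1: for betting fractions
`λ ∈ [λ_inf, λ_sup] ⊂ (−1/(1−θ), 1/θ)` and `y ∈ [0,1]`, the factor `1 + λ(y − θ)` is
positive and `|log(1 + λ(y − θ))|` is bounded by the stated maximum. -/
theorem log_sensitivity_betting_evalue
    (θ lamInf lamSup : ℝ) (hθ : θ ∈ Set.Ioo (0 : ℝ) 1)
    (hls : lamInf ≤ lamSup)
    (hlamInf : -1 / (1 - θ) < lamInf) (hlamSup : lamSup < 1 / θ)
    (lam y : ℝ) (hlam : lam ∈ Set.Icc lamInf lamSup) (hy : y ∈ Set.Icc (0 : ℝ) 1) :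
    0 < 1 + lam * (y - θ) ∧
      |Real.log (1 + lam * (y - θ))| ≤
        max (Real.log (1 + max (lamSup * (1 - θ)) (-lamInf * θ)))
          (-Real.log (1 + min (lamInf * (1 - θ)) (-lamSup * θ))) := by
  obtain ⟨h0, h1⟩ := hθ
  obtain ⟨hl, hu⟩ := hlam
  obtain ⟨hy0, hy1⟩ := hy
  have h1' : 0 < 1 - θ := by linarith
  have hy1' : 0 ≤ 1 - y := by linarith
  rw [div_lt_iff₀ h1'] at hlamInf
  rw [lt_div_iff₀ h0] at hlamSup
  have hM : lam * (y - θ) ≤ max (lamSup * (1 - θ)) (-lamInf * θ) := by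
    have a : lam * (1 - θ) ≤ max (lamSup * (1 - θ)) (-lamInf * θ) :=
      le_trans (mul_le_mul_of_nonneg_right hu h1'.le) (le_max_left _ _)
    have b : -lam * θ ≤ max (lamSup * (1 - θ)) (-lamInf * θ) :=
      le_trans (mul_le_mul_of_nonneg_right (neg_le_neg hl) h0.le) (le_max_right _ _)
    have a' := mul_le_mul_of_nonneg_left a hy0
    have b' := mul_le_mul_of_nonneg_left b hy1'
    linarith
  have hm : min (lamInf * (1 - θ)) (-lamSup * θ) ≤ lam * (y - θ) := by
    have a : min (lamInf * (1 - θ)) (-lamSup * θ) ≤ lam * (1 - θ) :=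
      le_trans (min_le_left _ _) (mul_le_mul_of_nonneg_right hl h1'.le)
    have b : min (lamInf * (1 - θ)) (-lamSup * θ) ≤ -lam * θ :=
      le_trans (min_le_right _ _) (mul_le_mul_of_nonneg_right (neg_le_neg hu) h0.le)
    have a' := mul_le_mul_of_nonneg_left a hy0
    have b' := mul_le_mul_of_nonneg_left b hy1'
    linarith
  have hpos : 0 < 1 + min (lamInf * (1 - θ)) (-lamSup * θ) := by
    have : -1 < min (lamInf * (1 - θ)) (-lamSup * θ) := lt_min hlamInf (by linarith)
    linarith
  have hp : 0 < 1 + lam * (y - θ) := by linarith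
  refine ⟨hp, abs_le'.mpr ⟨le_max_of_le_left ?_, le_max_of_le_right ?_⟩⟩
  · exact Real.log_le_log hp (by linarith)
  · exact neg_le_neg (Real.log_le_log hpos (by linarith))
end

section
/- Let 0 ≤ θ_inf ≤ θ_sup ≤ 1 and λ_inf ≤ λ_sup be reals with λ_sup·θ_sup < 1 and λ_inf·(1 − θ_inf) > −1. Then for every λ ∈ [λ_inf, λ_sup], every θ ∈ [θ_inf, θ_sup], and every y ∈ [0, 1], one has 1 + λ(y − θ) > 0 and | λ / (1 + λ(y − θ)) | ≤ max{ | λ_sup / (1 − λ_sup·θ_sup) | , | λ_inf / (1 + λ_inf·(1 − θ_inf)) | }. -/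
open Real

/-- Key inequality of Proposition 4.2: under the stated constraints on
`λ ∈ [λ_inf, λ_sup]`, `θ ∈ [θ_inf, θ_sup]` and `y ∈ [0,1]`, the factor `1 + λ(y − θ)` is
positive and `|λ/(1 + λ(y − θ))|` is bounded by the stated maximum. -/
theorem lipschitz_bound_betting_evalue
    (θInf θSup lamInf lamSup : ℝ)
    (h0 : 0 ≤ θInf) (h1 : θInf ≤ θSup) (h2 : θSup ≤ 1)
    (hls : lamInf ≤ lamSup)
    (ha : lamSup * θSup < 1) (hb : -1 < lamInf * (1 - θInf))
    (lam θ y : ℝ)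
    (hlam : lam ∈ Set.Icc lamInf lamSup) (hθ : θ ∈ Set.Icc θInf θSup)
    (hy : y ∈ Set.Icc (0 : ℝ) 1) :
    0 < 1 + lam * (y - θ) ∧
      |lam / (1 + lam * (y - θ))| ≤
        max |lamSup / (1 - lamSup * θSup)| |lamInf / (1 + lamInf * (1 - θInf))| := by
  obtain ⟨hl1, hl2⟩ := hlam
  obtain ⟨ht1, ht2⟩ := hθ
  obtain ⟨hy1, hy2⟩ := hy
  rcases le_total 0 lam with hp | hn
  · have e1 : lam * (-θSup) ≤ lam * (y - θ) :=
      mul_le_mul_of_nonneg_left (by linarith) hp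
    have e2 : lam * θSup ≤ lamSup * θSup :=
      mul_le_mul_of_nonneg_right hl2 (by linarith)
    have hd : 0 < 1 + lam * (y - θ) := by linarith
    have hS : 0 ≤ lamSup := hp.trans hl2
    have hD : 0 < 1 - lamSup * θSup := by linarith
    refine ⟨hd, le_max_of_le_left ?_⟩
    rw [abs_of_nonneg (div_nonneg hp hd.le), abs_of_nonneg (div_nonneg hS hD.le),
      div_le_div_iff₀ hd hD]
    have e3 : lamSup * (1 - lam * θSup) ≤ lamSup * (1 + lam * (y - θ)) :=
      mul_le_mul_of_nonneg_left (by linarith) hS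
    linarith
  · have e1 : lam * (1 - θInf) ≤ lam * (y - θ) :=
      mul_le_mul_of_nonpos_left (by linarith) hn
    have e2 : lamInf * (1 - θInf) ≤ lam * (1 - θInf) :=
      mul_le_mul_of_nonneg_right hl1 (by linarith)
    have hd : 0 < 1 + lam * (y - θ) := by linarith
    have hS : lamInf ≤ 0 := hl1.trans hn
    have hD : 0 < 1 + lamInf * (1 - θInf) := by linarith
    refine ⟨hd, le_max_of_le_right ?_⟩
    rw [abs_div, abs_div, abs_of_nonpos hn, abs_of_nonpos hS, abs_of_pos hd, abs_of_pos hD,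
      div_le_div_iff₀ hd hD]
    have e3 : (-lamInf) * (1 + lam * (1 - θInf)) ≤ (-lamInf) * (1 + lam * (y - θ)) :=
      mul_le_mul_of_nonneg_left (by linarith) (by linarith)
    linarith
end

section
/- Let 0 < a ≤ b be reals and n ≥ 1 a natural number. Let s₁, …, s_{n+1} and S be reals all lying in [a, b]. Then | log( ((n+1)·S) / (∑_{i=1}^n s_i + S) ) − log( ((n+2)·S) / (∑_{i=1}^{n+1} s_i + S) ) | ≤ 2·(b/a)/(n+1). -/
open Real Finset

/-- `Add one record` case of Proposition 4.3: the change in the log of the exchangeability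
e-value `(n+1)·S / (∑ sᵢ + S)` when one calibration score is added is at most
`2·(b/a)/(n+1)`, provided all scores lie in `[a, b]` with `0 < a ≤ b`. -/
theorem log_sensitivity_exch_add
    (a b : ℝ) (ha : 0 < a) (hab : a ≤ b) (n : ℕ) (hn : 1 ≤ n)
    (s : ℕ → ℝ) (S : ℝ)
    (hs : ∀ i < n + 1, s i ∈ Set.Icc a b) (hS : S ∈ Set.Icc a b) :
    |Real.log (((n : ℝ) + 1) * S / ((∑ i ∈ Finset.range n, s i) + S)) -
        Real.log (((n : ℝ) + 2) * S / ((∑ i ∈ Finset.range (n + 1), s i) + S))| ≤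
      2 * (b / a) / ((n : ℝ) + 1) := by
  have hm : (0 : ℝ) < (n : ℝ) + 1 := by positivity
  have hm2 : (0 : ℝ) < (n : ℝ) + 2 := by positivity
  have hsum : (n : ℝ) * a ≤ ∑ i ∈ Finset.range n, s i := by
    have h := Finset.card_nsmul_le_sum (Finset.range n) s a
      (fun i hi => (hs i (by have := Finset.mem_range.mp hi; omega)).1)
    simpa using h
  obtain ⟨hx1, hx2⟩ := hs n (by omega)
  obtain ⟨hS1, hS2⟩ := hS
  rw [Finset.sum_range_succ]
  generalize (∑ i ∈ Finset.range n, s i) = Q at *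
  generalize s n = x at *
  have hSp : 0 < S := by linarith
  have hxp : 0 < x := by linarith
  have hT : ((n : ℝ) + 1) * a ≤ Q + S := by linarith
  have hTp : 0 < Q + S := lt_of_lt_of_le (by positivity) hT
  have hTx : 0 < Q + x + S := by linarith
  rw [Real.log_div (by positivity) hTp.ne', Real.log_div (by positivity) hTx.ne',
    Real.log_mul hm.ne' hSp.ne', Real.log_mul hm2.ne' hSp.ne']
  have h1 : Real.log (n + 1) ≤ Real.log (n + 2) := Real.log_le_log hm (by linarith)
  have h2 : Real.log (Q + S) ≤ Real.log (Q + x + S) := Real.log_le_log hTp (by linarith)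
  have h3 : Real.log (n + 2) - Real.log (n + 1) ≤ 1 / ((n : ℝ) + 1) := by
    rw [← Real.log_div hm2.ne' hm.ne']
    refine (Real.log_le_sub_one_of_pos (by positivity)).trans (le_of_eq ?_)
    field_simp
    ring
  have h4 : Real.log (Q + x + S) - Real.log (Q + S) ≤ x / (Q + S) := by
    rw [← Real.log_div hTx.ne' hTp.ne']
    refine (Real.log_le_sub_one_of_pos (by positivity)).trans (le_of_eq ?_)
    field_simp
    ring
  have h5 : x / (Q + S) ≤ b / (((n : ℝ) + 1) * a) :=
    div_le_div₀ (by linarith) hx2 (by positivity) hT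
  have h6 : b / (((n : ℝ) + 1) * a) = (b / a) / ((n : ℝ) + 1) := by
    field_simp
  have h7 : 1 / ((n : ℝ) + 1) ≤ (b / a) / ((n : ℝ) + 1) := by
    have : 1 ≤ b / a := (one_le_div ha).mpr hab
    gcongr
  have h8 : 2 * (b / a) / ((n : ℝ) + 1) = 2 * ((b / a) / ((n : ℝ) + 1)) := by ring
  have h9 : 0 < 1 / ((n : ℝ) + 1) := by positivity
  rw [h8, abs_le]
  constructor <;> linarith
end

section
/- Let 0 < a ≤ b be reals and n ≥ 1 a natural number. Let s₁, …, s_n and S be reals all lying in [a, b]. Then | log( ((n+1)·S) / (∑_{i=1}^n s_i + S) ) − log( (n·S) / (∑_{i=1}^{n−1} s_i + S) ) | ≤ 2·(b/a)/(n+1). -/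
open Real Finset

/-- `Remove one record` case of Proposition 4.3: the change in the log of the
exchangeability e-value `(n+1)·S / (∑ sᵢ + S)` when one calibration score is removed is
at most `2·(b/a)/(n+1)`, provided all scores lie in `[a, b]` with `0 < a ≤ b`. -/
theorem log_sensitivity_exch_remove
    (a b : ℝ) (ha : 0 < a) (hab : a ≤ b) (n : ℕ) (hn : 1 ≤ n)
    (s : ℕ → ℝ) (S : ℝ)
    (hs : ∀ i < n, s i ∈ Set.Icc a b) (hS : S ∈ Set.Icc a b) :
    |Real.log (((n : ℝ) + 1) * S / ((∑ i ∈ Finset.range n, s i) + S)) -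
        Real.log ((n : ℝ) * S / ((∑ i ∈ Finset.range (n - 1), s i) + S))| ≤
      2 * (b / a) / ((n : ℝ) + 1) := by
  obtain ⟨m, rfl⟩ : ∃ m, n = m + 1 := ⟨n - 1, by omega⟩
  have hS0 : 0 < S := lt_of_lt_of_le ha hS.1
  obtain ⟨hx1, hx2⟩ := hs m (by omega)
  have hsum : (m : ℝ) * a ≤ ∑ i ∈ Finset.range m, s i := by
    have h := Finset.card_nsmul_le_sum (Finset.range m) s a
      (fun i hi => (hs i (by have := Finset.mem_range.mp hi; omega)).1)
    simpa using h
  rw [Nat.add_sub_cancel, Finset.sum_range_succ]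
  generalize hx : s m = x at *
  generalize hN : ((m + 1 : ℕ) : ℝ) = N at *
  have hNm : N = m + 1 := by rw [← hN]; push_cast; ring
  have hN1 : 1 ≤ N := by rw [hNm]; have : (0 : ℝ) ≤ m := Nat.cast_nonneg m; linarith
  have hN0 : 0 < N := by linarith
  obtain ⟨T, hT⟩ : ∃ T, T = ∑ i ∈ Finset.range m, s i + S := ⟨_, rfl⟩
  have hTa : N * a ≤ T := by rw [hT, hNm]; linarith [hS.1]
  have hNa : 0 < N * a := by positivity
  have hT0 : 0 < T := by linarith
  have hx0 : 0 < x := by linarith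
  rw [show ∑ i ∈ Finset.range m, s i + x + S = T + x by rw [hT]; ring, ← hT]
  rw [Real.log_div (by positivity) (by positivity), Real.log_div (by positivity) (by positivity),
    Real.log_mul (by positivity) (by positivity), Real.log_mul (by positivity) (by positivity)]
  have key : ∀ u v : ℝ, 0 < u → 0 < v → Real.log (u + v) - Real.log u ≤ v / u := by
    intro u v hu hv
    rw [← Real.log_div (by positivity) (by positivity)]
    have := Real.log_le_sub_one_of_pos (show 0 < (u + v) / u by positivity)
    have h2 : (u + v) / u - 1 = v / u := by field_simp; ring
    linarith
  have k1 := key N 1 hN0 one_pos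
  have k2 := key T x hT0 hx0
  have l1 := Real.log_le_log hN0 (show N ≤ N + 1 by linarith)
  have l2 := Real.log_le_log hT0 (show T ≤ T + x by linarith)
  have hb : 0 < b := by linarith
  have e0 : 2 * (b / a) / (N + 1) = (2 * b) / (a * (N + 1)) := by field_simp
  have e1 : 1 / N ≤ b / (N * a) := by
    rw [div_le_div_iff₀ hN0 hNa]; nlinarith
  have e2 : x / T ≤ b / (N * a) := div_le_div₀ hb.le hx2 hNa hTa
  have e3 : b / (N * a) ≤ 2 * (b / a) / (N + 1) := by
    rw [e0, div_le_div_iff₀ hNa (by positivity)]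
    have : 0 < b * a := by positivity
    nlinarith
  rw [abs_le]
  constructor <;> linarith
end

section
/- Let (Ω, P) be a probability space and let ξ : Ω → ℝ be an integrable random variable that is not almost surely constant, such that e^{−ξ} is integrable and 𝔼[e^{−ξ}] ≤ 1. Then 𝔼[ξ] > 0. -/
open MeasureTheory

/-- Bias is necessary (Proposition B.3): if `ξ` is integrable, not almost surely constant,
and `𝔼[e^{−ξ}] ≤ 1`, then `𝔼[ξ] > 0`. -/
theorem bias_is_necessary
    {Ω : Type*} [MeasurableSpace Ω] (P : Measure Ω) [IsProbabilityMeasure P]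
    (ξ : Ω → ℝ) (hint : Integrable ξ P)
    (hnc : ¬ ∃ c : ℝ, ξ =ᵐ[P] fun _ => c)
    (hexp : Integrable (fun ω => Real.exp (-ξ ω)) P)
    (hmean : ∫ ω, Real.exp (-ξ ω) ∂P ≤ 1) :
    0 < ∫ ω, ξ ω ∂P := by
  rcases strictConvexOn_exp.ae_eq_const_or_map_average_lt (μ := P) (f := fun ω => -ξ ω)
    Real.continuous_exp.continuousOn isClosed_univ (by simp) hint.neg hexp with h | h
  · refine absurd ⟨-(⨍ x, -ξ x ∂P), ?_⟩ hnc
    filter_upwards [h] with ω hω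
    simp only [Function.const_apply] at hω
    linarith
  · rw [average_eq_integral, average_eq_integral, integral_neg] at h
    have h1 := Real.exp_lt_one_iff.mp (h.trans_le hmean)
    linarith
end
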